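/- arXiv:1211.6395 — 12 statements merged into one kernel-verified Lean document; each statement's English description precedes it below -/
import Mathlib

section
/- Let Γ be a countable group with a measure-preserving action α on a standard probability space (X, μ), and let N be a normal subgroup of Γ. Suppose the restriction of α to N is essentially free (μ(Fix(h)) = 0 for every h ∈ N with h ≠ e). Then for every γ ∈ Γ such that the conjugacy set {hγh⁻¹ : h ∈ N} is infinite, one has μ(Fix(γ)) = 0. -/
open MeasureTheory

/-- Conjugate elements of a measure-preserving action have fixed-point sets of equal measure. -/
theorem measure_fixedPoints_conj {Γ : Type*} [Group Γ] {X : Type*} [MeasurableSpace X]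
    {μ : Measure X} [MulAction Γ X] {h γ : Γ}
    (hpres : MeasurePreserving (fun x : X => h⁻¹ • x) μ μ)
    (hγ : MeasurableSet {x : X | γ • x = x}) :
    μ {x : X | (h * γ * h⁻¹) • x = x} = μ {x : X | γ • x = x} := by
  rw [← hpres.measure_preimage hγ.nullMeasurableSet]
  congr 1
  ext x
  simp only [Set.mem_ofPred_eq, Set.mem_preimage, mul_smul]
  exact eq_inv_smul_iff.symm

/-- The quotient of two conjugates of `γ` by elements of a normal subgroup `N` lies in `N`. -/
theorem Subgroup.Normal.inv_conj_mul_conj_mem {Γ : Type*} [Group Γ] {N : Subgroup Γ}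
    (hN : N.Normal) {h k : Γ} (hh : h ∈ N) (hk : k ∈ N) (γ : Γ) :
    (h * γ * h⁻¹)⁻¹ * (k * γ * k⁻¹) ∈ N := by
  have hmem := N.mul_mem (N.mul_mem hh
    (hN.conj_mem (h⁻¹ * k) (N.mul_mem (N.inv_mem hh) hk) γ⁻¹)) (N.inv_mem hk)
  convert hmem using 1
  group

/-- Proposition 4.4: if the restriction of a measure-preserving action of a countable
group `Γ` to a normal subgroup `N` is essentially free, then any `γ ∈ Γ` whose
`N`-conjugacy set `{hγh⁻¹ : h ∈ N}` is infinite has null fixed-point set. -/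
theorem fix_null_of_infinite_N_conjugates
    {Γ : Type*} [Group Γ] [Countable Γ]
    {X : Type*} [MeasurableSpace X] [StandardBorelSpace X]
    (μ : Measure X) [IsProbabilityMeasure μ] [MulAction Γ X]
    (hpres : ∀ γ : Γ, MeasurePreserving (fun x : X => γ • x) μ μ)
    (hFix : ∀ γ : Γ, MeasurableSet {x : X | γ • x = x})
    (N : Subgroup Γ) (hN : N.Normal)
    (hfree : ∀ h ∈ N, h ≠ 1 → μ {x : X | h • x = x} = 0)
    (γ : Γ) (hconj : {g : Γ | ∃ h ∈ N, h * γ * h⁻¹ = g}.Infinite) :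
    μ {x : X | γ • x = x} = 0 := by
  set S : Set Γ := {g : Γ | ∃ h ∈ N, h * γ * h⁻¹ = g}
  have : Infinite S := hconj.to_subtype
  have hdisj : Pairwise (Function.onFun (AEDisjoint μ)
      fun g : S => {x : X | (g : Γ) • x = x}) := by
    rintro ⟨_, h, hh, rfl⟩ ⟨_, k, hk, rfl⟩ hne
    refine measure_mono_null ?_ (hfree _ (hN.inv_conj_mul_conj_mem hh hk γ) fun heq =>
      hne (Subtype.ext (inv_mul_eq_one.mp heq)))
    rintro x ⟨hx, hx'⟩
    simp only [Set.mem_ofPred_eq] at hx hx' ⊢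
    rw [mul_smul, hx', inv_smul_eq_iff, hx]
  have hle := tsum_measure_le_measure_univ
    (fun g : S => (hFix (g : Γ)).nullMeasurableSet) hdisj
  have hconst (g : S) : μ {x : X | (g : Γ) • x = x} = μ {x : X | γ • x = x} := by
    obtain ⟨_, h, -, rfl⟩ := g
    exact measure_fixedPoints_conj (hpres h⁻¹) (hFix γ)
  by_contra hpos
  rw [tsum_congr hconst, ENNReal.tsum_const_eq_top_of_ne_zero hpos] at hle
  exact measure_ne_top μ _ (top_le_iff.mp hle)
end

section
/- Let Γ be a countable ICC group and let K be a subgroup of Γ of finite index. Let α be a measure-preserving action of Γ on a standard probability space (X, μ). If the restriction of α to K is essentially free (μ(Fix(k)) = 0 for every k ∈ K with k ≠ e), then α is essentially free (μ(Fix(γ)) = 0 for every γ ∈ Γ with γ ≠ e). -/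
open MeasureTheory

/-- The fixed-point set of `δ * γ * δ⁻¹` is the translate by `δ` of that of `γ`. -/
theorem setOf_smul_conj_eq {G X : Type*} [Group G] [MulAction G X] (γ δ : G) :
    {x : X | (δ * γ * δ⁻¹) • x = x} = (fun x : X => δ⁻¹ • x) ⁻¹' {x : X | γ • x = x} := by
  ext x
  simp only [Set.mem_ofPred_eq, Set.mem_preimage, mul_smul]
  rw [eq_inv_smul_iff]

/-- Proposition 4.5: if `Γ` is a countable ICC group, `K ≤ Γ` has finite index, and a
measure-preserving action of `Γ` restricts to an essentially free action of `K`, then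
the action itself is essentially free. -/
theorem essentially_free_of_finite_index_restriction
    {Γ : Type*} [Group Γ] [Countable Γ]
    (hICC : ∀ γ : Γ, γ ≠ 1 → {g : Γ | ∃ δ : Γ, δ * γ * δ⁻¹ = g}.Infinite)
    (K : Subgroup Γ) (hK : K.index ≠ 0)
    {X : Type*} [MeasurableSpace X] [StandardBorelSpace X]
    (μ : Measure X) [IsProbabilityMeasure μ] [MulAction Γ X]
    (hpres : ∀ γ : Γ, MeasurePreserving (fun x : X => γ • x) μ μ)
    (hFix : ∀ γ : Γ, MeasurableSet {x : X | γ • x = x})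
    (hfree : ∀ k ∈ K, k ≠ 1 → μ {x : X | k • x = x} = 0) :
    ∀ γ : Γ, γ ≠ 1 → μ {x : X | γ • x = x} = 0 := by
  intro γ hγ
  have : K.FiniteIndex := ⟨hK⟩
  set S : Set Γ := {g : Γ | ∃ δ : Γ, δ * γ * δ⁻¹ = g}
  have : Infinite S := (hICC γ hγ).to_subtype
  obtain ⟨q, hq⟩ := Finite.exists_infinite_fiber (fun g : S => (g.1 : Γ ⧸ K))
  set ι := (fun g : S => (g.1 : Γ ⧸ K)) ⁻¹' {q}
  by_contra hne
  have hmeas : ∀ i : ι, μ {x : X | i.1.1 • x = x} = μ {x : X | γ • x = x} := by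
    rintro ⟨⟨g, δ, rfl⟩, -⟩
    rw [← (hpres δ⁻¹).measure_preimage (hFix γ).nullMeasurableSet]
    exact congrArg μ (setOf_smul_conj_eq γ δ)
  have hdisj : Pairwise (Function.onFun (AEDisjoint μ)
      fun i : ι => {x : X | i.1.1 • x = x}) := by
    intro i j hij
    have hmem : i.1.1⁻¹ * j.1.1 ∈ K := QuotientGroup.eq.mp (i.2.trans j.2.symm)
    refine measure_mono_null ?_ (hfree _ hmem fun h =>
      hij (Subtype.ext (Subtype.ext (inv_mul_eq_one.mp h))))
    rintro x ⟨hi, hj⟩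
    change (i.1.1⁻¹ * j.1.1) • x = x
    rw [mul_smul, inv_smul_eq_iff]
    exact hj.trans hi.symm
  have htop := measure_iUnion₀ hdisj fun i => (hFix i.1.1).nullMeasurableSet
  simp_rw [hmeas] at htop
  rw [ENNReal.tsum_const_eq_top_of_ne_zero hne] at htop
  exact measure_ne_top μ _ htop
end

section
/- Let Γ be a countable group with a measure-preserving action a on a standard probability space (X, μ), and let N be a normal subgroup of Γ. Suppose that both N and its centralizer C_Γ(N) = {γ ∈ Γ : γn = nγ for all n ∈ N} are ICC groups. If the restriction of a to N and the restriction of a to C_Γ(N) are both essentially free, then a is essentially free. -/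
open MeasureTheory

/-- If `N` is a normal subgroup in which every non-identity element has infinitely many
`N`-conjugates, then any `γ` with finitely many `N`-conjugates centralizes `N`. -/
theorem mem_centralizer_of_finite_conjugates {Γ : Type*} [Group Γ]
    {N : Subgroup Γ} (hN : N.Normal)
    (hICC : ∀ g ∈ N, g ≠ 1 → {x : Γ | ∃ δ ∈ N, δ * g * δ⁻¹ = x}.Infinite)
    {γ : Γ} (hfin : {x : Γ | ∃ δ ∈ N, δ * γ * δ⁻¹ = x}.Finite) :
    γ ∈ Subgroup.centralizer (N : Set Γ) := by
  rw [Subgroup.mem_centralizer_iff]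
  intro n hn
  have hmem : n * γ * n⁻¹ * γ⁻¹ ∈ N := by
    have h := N.mul_mem hn (hN.conj_mem n⁻¹ (N.inv_mem hn) γ)
    simpa only [mul_assoc] using h
  by_contra hne
  refine hICC _ hmem (fun h => hne ?_) ?_
  · rwa [mul_inv_eq_one, mul_inv_eq_iff_eq_mul] at h
  · refine (hfin.image2 (fun a b => a * b⁻¹) hfin).subset ?_
    rintro _ ⟨δ, hδ, rfl⟩
    exact ⟨_, ⟨δ * n, N.mul_mem hδ hn, rfl⟩, _, ⟨δ, hδ, rfl⟩, by group⟩

/-- A group element with infinitely many conjugates by a normal subgroup `N` acting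
essentially freely has a null set of fixed points. -/
theorem measure_fixed_eq_zero_of_infinite_conjugates {Γ : Type*} [Group Γ]
    {X : Type*} [MeasurableSpace X]
    (μ : Measure X) [IsFiniteMeasure μ] [MulAction Γ X]
    (hpres : ∀ γ : Γ, MeasurePreserving (fun x : X => γ • x) μ μ)
    (hFix : ∀ γ : Γ, MeasurableSet {x : X | γ • x = x})
    {N : Subgroup Γ} (hN : N.Normal)
    (hfree : ∀ h ∈ N, h ≠ 1 → μ {x : X | h • x = x} = 0)
    {γ : Γ} (hinf : {x : Γ | ∃ δ ∈ N, δ * γ * δ⁻¹ = x}.Infinite) :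
    μ {x : X | γ • x = x} = 0 := by
  by_contra hne
  set S := {x : Γ | ∃ δ ∈ N, δ * γ * δ⁻¹ = x}
  have hmeas : ∀ g : S, μ {x : X | γ • x = x} = μ {x : X | (g : Γ) • x = x} := by
    rintro ⟨_, δ, hδ, rfl⟩
    rw [← (hpres δ⁻¹).measure_preimage (hFix γ).nullMeasurableSet]
    congr 1
    ext x
    simp only [Set.mem_preimage, Set.mem_ofPred_eq, mul_smul]
    exact eq_inv_smul_iff
  have hdisj : Pairwise (Function.onFun (AEDisjoint μ) fun g : S => {x : X | (g : Γ) • x = x}) := by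
    rintro ⟨a, ha⟩ ⟨b, hb⟩ hab
    have hmem : ∀ c ∈ S, γ⁻¹ * c ∈ N := by
      rintro _ ⟨δ, hδ, rfl⟩
      have h := N.mul_mem (hN.conj_mem δ hδ γ⁻¹) (N.inv_mem hδ)
      simpa only [inv_inv, mul_assoc] using h
    have hq : a⁻¹ * b ∈ N := by
      have h := N.mul_mem (N.inv_mem (hmem a ha)) (hmem b hb)
      simpa [mul_assoc] using h
    refine measure_mono_null ?_ (hfree _ hq fun h => hab (Subtype.ext (inv_mul_eq_one.1 h)))
    rintro x ⟨hxa, hxb⟩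
    simp only [Set.mem_ofPred_eq] at hxa hxb ⊢
    rw [mul_smul, hxb, inv_smul_eq_iff, hxa]
  have hfin := Measure.finite_const_le_meas_of_disjoint_iUnion₀ μ (pos_iff_ne_zero.2 hne)
    (fun g : S => (hFix g).nullMeasurableSet) hdisj (measure_ne_top μ _)
  have huniv : {g : S | μ {x : X | γ • x = x} ≤ μ {x : X | (g : Γ) • x = x}} = Set.univ :=
    Set.eq_univ_of_forall fun g => (hmeas g).le
  rw [huniv, Set.finite_univ_iff] at hfin
  exact hinf hfin

/-- Proposition 4.11: let `N` be a normal subgroup of a countable group `Γ` such that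
both `N` and its centralizer `C_Γ(N)` are ICC. If a measure-preserving action of `Γ`
restricts to essentially free actions of both `N` and `C_Γ(N)`, then it is essentially
free. -/
theorem essentially_free_of_normal_and_centralizer
    {Γ : Type*} [Group Γ] [Countable Γ]
    {X : Type*} [MeasurableSpace X] [StandardBorelSpace X]
    (μ : Measure X) [IsProbabilityMeasure μ] [MulAction Γ X]
    (hpres : ∀ γ : Γ, MeasurePreserving (fun x : X => γ • x) μ μ)
    (hFix : ∀ γ : Γ, MeasurableSet {x : X | γ • x = x})
    (N : Subgroup Γ) (hN : N.Normal)
    (hICCN : ∀ g ∈ N, g ≠ 1 → {x : Γ | ∃ δ ∈ N, δ * g * δ⁻¹ = x}.Infinite)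
    (hICCC : ∀ g ∈ Subgroup.centralizer (N : Set Γ), g ≠ 1 →
      {x : Γ | ∃ δ ∈ Subgroup.centralizer (N : Set Γ), δ * g * δ⁻¹ = x}.Infinite)
    (hfreeN : ∀ h ∈ N, h ≠ 1 → μ {x : X | h • x = x} = 0)
    (hfreeC : ∀ h ∈ Subgroup.centralizer (N : Set Γ), h ≠ 1 →
      μ {x : X | h • x = x} = 0) :
    ∀ γ : Γ, γ ≠ 1 → μ {x : X | γ • x = x} = 0 := by
  intro γ hγ
  by_cases hfin : {x : Γ | ∃ δ ∈ N, δ * γ * δ⁻¹ = x}.Finite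
  · exact hfreeC γ (mem_centralizer_of_finite_conjugates hN hICCN hfin) hγ
  · exact measure_fixed_eq_zero_of_infinite_conjugates μ hpres hFix hN hfreeN hfin
end

section
/- Let Γ be a weak* Powers group, i.e., a group such that for every γ ∈ Γ ∖ {e} and every integer N ≥ 1 there exist a partition Γ = C ⊔ D of Γ into two disjoint sets and elements α₁, …, α_N ∈ Γ such that γC ∩ C = ∅ and αⱼD ∩ αₖD = ∅ for all j ≠ k. Then Γ has property (BP). -/
/-- A group `Γ` has property (BP) if for every `γ ≠ 1` and every `n ≥ 2` there are
`α₁, …, αₙ ∈ Γ`, a subgroup `H ≤ Γ`, and pairwise disjoint subsets `T₁, …, Tₙ ⊆ H`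
such that `αⱼγαⱼ⁻¹·(H ∖ Tⱼ) ⊆ Tⱼ` for every `j`. -/
def HasBP (Γ : Type*) [Group Γ] : Prop :=
  ∀ γ : Γ, γ ≠ 1 → ∀ n : ℕ, 2 ≤ n →
    ∃ (α : Fin n → Γ) (H : Subgroup Γ) (T : Fin n → Set Γ),
      (∀ j, T j ⊆ (H : Set Γ)) ∧
      (Pairwise fun i j => Disjoint (T i) (T j)) ∧
      (∀ j : Fin n, ∀ h ∈ H, h ∉ T j → α j * γ * (α j)⁻¹ * h ∈ T j)

/-- Theorem 5.4.(1): every weak* Powers group has property (BP). -/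
theorem hasBP_of_weakStarPowers {Γ : Type*} [Group Γ]
    (hP : ∀ γ : Γ, γ ≠ 1 → ∀ N : ℕ, 1 ≤ N →
      ∃ (C D : Set Γ) (α : Fin N → Γ),
        C ∪ D = Set.univ ∧ Disjoint C D ∧
        (∀ c ∈ C, γ * c ∉ C) ∧
        (∀ j k : Fin N, j ≠ k →
          Disjoint ((fun d => α j * d) '' D) ((fun d => α k * d) '' D))) :
    HasBP Γ := by
  intro γ hγ n hn
  obtain ⟨C, D, α, hCD, -, hC, hD⟩ := hP γ hγ n (by omega)
  have mem_or : ∀ x, x ∈ C ∨ x ∈ D := Set.eq_univ_iff_forall.mp hCD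
  refine ⟨α, ⊤, fun j => (fun d => α j * d) '' D, fun _ => Set.subset_univ _,
    fun i j hij => hD i j hij, fun j h _ hh => ?_⟩
  have hc : (α j)⁻¹ * h ∈ C :=
    (mem_or _).resolve_right fun hd => hh ⟨_, hd, mul_inv_cancel_left _ _⟩
  exact ⟨γ * ((α j)⁻¹ * h), (mem_or _).resolve_left (hC _ hc), by simp only [mul_assoc]⟩
end

section
/- Let Γ be a group with property P_nai*: for every γ ∈ Γ there exists an element α ∈ Γ of infinite order such that the canonical homomorphism from the free product ⟨γ⟩ ∗ ⟨α⟩ of the cyclic subgroups ⟨γ⟩ and ⟨α⟩ to Γ (the homomorphism induced by the two inclusion maps ⟨γ⟩ ↪ Γ and ⟨α⟩ ↪ Γ) is injective. Then Γ has property (BP). -/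
/-- Multiplying a reduced word that does not begin in the factor `i` by a nontrivial element of
that factor gives a word beginning in the factor `i`. -/
theorem Monoid.CoprodI.Word.fstIdx_of_smul {ι : Type*} {M : ι → Type*} [∀ i, Monoid (M i)]
    [DecidableEq ι] [∀ i, DecidableEq (M i)] {i : ι} {m : M i} (hm : m ≠ 1) {w : Word M}
    (hw : w.fstIdx ≠ some i) : ((of m : CoprodI M) • w).fstIdx = some i := by
  rw [← cons_eq_smul (h1 := hw) (h2 := hm), fstIdx_cons]

/-- A free product `A ∗ B` contains a set (the reduced words beginning with a letter of `A`) whose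
complement is mapped into it by nontrivial elements of `A`, and which is mapped into its complement
by nontrivial elements of `B`. -/
theorem Monoid.Coprod.exists_ping_pong_set.{u, v} (A : Type u) (B : Type v) [Group A]
    [Group B] :
    ∃ S : Set (Monoid.Coprod A B),
      (∀ a : A, a ≠ 1 → ∀ x ∉ S, inl a * x ∈ S) ∧
      (∀ b : B, b ≠ 1 → ∀ x ∈ S, inr b * x ∉ S) := by
  classical
  let M : Bool → Type (max u v) := fun i => cond i (ULift.{v} A) (ULift.{u} B)
  let _ : ∀ i, Group (M i) := fun i =>
    match i with
    | true => (inferInstance : Group (ULift.{v} A))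
    | false => (inferInstance : Group (ULift.{u} B))
  let toA : A →* M true := (MulEquiv.ulift.{u, v} (α := A)).symm.toMonoidHom
  let toB : B →* M false := (MulEquiv.ulift.{v, u} (α := B)).symm.toMonoidHom
  have htoA : Function.Injective toA := (MulEquiv.ulift.{u, v} (α := A)).symm.injective
  have htoB : Function.Injective toB := (MulEquiv.ulift.{v, u} (α := B)).symm.injective
  let ψ : Monoid.Coprod A B →* CoprodI M :=
    lift ((CoprodI.of (M := M) (i := true)).comp toA) ((CoprodI.of (M := M) (i := false)).comp toB)
  refine ⟨{x | (ψ x • (CoprodI.Word.empty : CoprodI.Word M)).fstIdx = some true}, ?_, ?_⟩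
  · intro a ha x hx
    have hψ : ψ (inl a * x) = CoprodI.of (toA a) * ψ x := by simp [ψ]
    rw [Set.mem_ofPred_eq, hψ, mul_smul]
    exact CoprodI.Word.fstIdx_of_smul ((map_ne_one_iff toA htoA).2 ha) hx
  · intro b hb x hx
    have hψ : ψ (inr b * x) = CoprodI.of (toB b) * ψ x := by simp [ψ]
    rw [Set.mem_ofPred_eq] at hx
    rw [Set.mem_ofPred_eq, hψ, mul_smul,
      CoprodI.Word.fstIdx_of_smul ((map_ne_one_iff toB htoB).2 hb) (by simp [hx])]
    simp

/-- Theorem 5.4.(2): property P_nai* implies property (BP). Here P_nai* says: for every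
`γ` there is an infinite-order `α` such that the canonical homomorphism
`⟨γ⟩ ∗ ⟨α⟩ → Γ` is injective. -/
theorem hasBP_of_Pnai {Γ : Type*} [Group Γ]
    (h : ∀ γ : Γ, ∃ α : Γ, (∀ k : ℤ, k ≠ 0 → α ^ k ≠ 1) ∧
      Function.Injective
        ⇑(Monoid.Coprod.lift (Subgroup.zpowers γ).subtype (Subgroup.zpowers α).subtype)) :
    HasBP Γ := by
  intro γ hγ n _
  obtain ⟨α, hα, hinj⟩ := h γ
  obtain ⟨S, hSγ, hSα⟩ :=
    Monoid.Coprod.exists_ping_pong_set (Subgroup.zpowers γ) (Subgroup.zpowers α)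
  set F := Monoid.Coprod.lift (Subgroup.zpowers γ).subtype (Subgroup.zpowers α).subtype
  let c : Subgroup.zpowers γ := ⟨γ, Subgroup.mem_zpowers γ⟩
  let a : Subgroup.zpowers α := ⟨α, Subgroup.mem_zpowers α⟩
  have hc : c ≠ 1 := fun hc => hγ (congrArg Subtype.val hc)
  have ha : ∀ k : ℤ, k ≠ 0 → a ^ k ≠ 1 := fun k hk hak =>
    hα k hk (by simpa [a] using congrArg Subtype.val hak)
  have hFc : F (Monoid.Coprod.inl c) = γ := by simp [F, c]
  have hFa : F (Monoid.Coprod.inr a) = α := by simp [F, a]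
  refine ⟨fun j => α ^ (j : ℤ), F.range,
    fun j => F '' {x | Monoid.Coprod.inr (a ^ (-(j : ℤ))) * x ∈ S}, ?_, ?_, ?_⟩
  · rintro j _ ⟨x, -, rfl⟩
    exact ⟨x, rfl⟩
  · intro i j hij
    rw [Set.disjoint_image_iff hinj, Set.disjoint_left]
    intro x hi hj
    have hne : (i : ℤ) - j ≠ 0 := by
      intro h0
      exact hij (Fin.ext (by lia))
    refine hSα _ (ha _ hne) _ hi ?_
    rw [← mul_assoc, ← map_mul, ← zpow_add]
    rwa [show (i : ℤ) - j + -i = -j by ring]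
  · rintro j _ ⟨x, rfl⟩ hx
    have hxS : Monoid.Coprod.inr (a ^ (-(j : ℤ))) * x ∉ S := fun hmem => hx ⟨x, hmem, rfl⟩
    refine ⟨Monoid.Coprod.inr (a ^ (j : ℤ)) *
      (Monoid.Coprod.inl c * (Monoid.Coprod.inr (a ^ (-(j : ℤ))) * x)), ?_, ?_⟩
    · rw [Set.mem_ofPred_eq, ← mul_assoc, ← map_mul, ← zpow_add, neg_add_cancel, zpow_zero, map_one,
        one_mul]
      exact hSγ c hc _ hxS
    · simp only [map_mul, map_inv, map_zpow, hFc, hFa, zpow_neg, mul_assoc]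
end

section
/- Let Γ be a nontrivial group with property (BP). Then Γ contains a non-abelian free subgroup; that is, there exists an injective group homomorphism from the free group on two generators into Γ. -/
open scoped Pointwise

universe u in
/-- The ping-pong lemma for two players, with no constraint on the universe of the group. -/
theorem FreeGroup.injective_lift_bool_of_ping_pong {G : Type u} [Group G] {β : Type*}
    [MulAction G β] (a : Bool → G) (X Y : Bool → Set β) (hXne : ∀ i, (X i).Nonempty)
    (hX : Pairwise fun i j => Disjoint (X i) (X j))
    (hY : Pairwise fun i j => Disjoint (Y i) (Y j))
    (hXY : ∀ i j, Disjoint (X i) (Y j))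
    (haX : ∀ i, a i • (Y i)ᶜ ⊆ X i) (haY : ∀ i, (a i)⁻¹ • (X i)ᶜ ⊆ Y i) :
    Function.Injective (FreeGroup.lift a) := by
  have hlift : Function.Injective (FreeGroup.lift fun i : ULift.{u} Bool => a i.down) :=
    FreeGroup.injective_lift_of_ping_pong _ (fun i => X i.down) (fun i => Y i.down)
      (fun i => hXne i.down) (fun _ _ hij => hX (ULift.down_injective.ne hij))
      (fun _ _ hij => hY (ULift.down_injective.ne hij)) (fun i j => hXY i.down j.down)
      (fun i => haX i.down) (fun i => haY i.down)
  have hcomp : FreeGroup.lift a = (FreeGroup.lift fun i : ULift.{u} Bool => a i.down).comp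
      (FreeGroup.freeGroupCongr Equiv.ulift.symm).toMonoidHom := by
    ext i
    simp
  rw [hcomp]
  exact hlift.comp (MulEquiv.injective _)

/-- If `g` maps the complement of `T` into `T`, then so does `g⁻¹`. -/
theorem inv_smul_mem_of_forall_smul_mem {G β : Type*} [Group G] [MulAction G β] {g : G}
    {T : Set β} (hg : ∀ x ∉ T, g • x ∈ T) : ∀ x ∉ T, g⁻¹ • x ∈ T := by
  intro x hx
  by_contra hgx
  exact hx (by simpa using hg _ hgx)

/-- Four elements, each mapping the complement of its own set into that set, yield a free group
on the two products of consecutive elements. -/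
theorem FreeGroup.injective_lift_mul_of_ping_pong {G β : Type*} [Group G] [MulAction G β]
    (g : Bool × Bool → G) (T : Bool × Bool → Set β) (hne : ∀ p, (T p).Nonempty)
    (hT : Pairwise fun p q => Disjoint (T p) (T q)) (hg : ∀ p, ∀ x ∉ T p, g p • x ∈ T p) :
    Function.Injective (FreeGroup.lift fun i => g (i, true) * g (i, false)) := by
  have notMem {p q : Bool × Bool} (hpq : p ≠ q) {x : β} (hx : x ∈ T p) : x ∉ T q :=
    Set.disjoint_left.mp (hT hpq) hx
  refine FreeGroup.injective_lift_bool_of_ping_pong _ (fun i => T (i, true))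
    (fun i => T (i, false)) (fun i => hne _) (fun i j hij => hT (by simpa using hij))
    (fun i j hij => hT (by simpa using hij)) (fun i j => hT (by simp)) (fun i => ?_) (fun i => ?_)
  · rintro _ ⟨x, hx, rfl⟩
    simp only [mul_smul]
    exact hg _ _ (notMem (by simp) (hg _ _ hx))
  · rintro _ ⟨x, hx, rfl⟩
    simp only [mul_inv_rev, mul_smul]
    exact inv_smul_mem_of_forall_smul_mem (hg _) _
      (notMem (by simp) (inv_smul_mem_of_forall_smul_mem (hg _) _ hx))

/-- Theorem 5.4.(4): a nontrivial group with property (BP) contains a non-abelian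
free subgroup. -/
theorem free_subgroup_of_hasBP {Γ : Type*} [Group Γ] [Nontrivial Γ] (h : HasBP Γ) :
    ∃ f : FreeGroup Bool →* Γ, Function.Injective f := by
  obtain ⟨γ, hγ⟩ := exists_ne (1 : Γ)
  obtain ⟨α, H, T, hTH, hT, hmaps⟩ := h γ hγ 4 (by norm_num)
  have hne (j : Fin 4) : (T j).Nonempty := by
    by_contra hempty
    rw [Set.not_nonempty_iff_eq_empty] at hempty
    simpa [hempty] using hmaps j 1 H.one_mem
  have hmem (j : Fin 4) : α j * γ * (α j)⁻¹ ∈ H := by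
    obtain ⟨i, hij⟩ := exists_ne j
    obtain ⟨x, hx⟩ := hne i
    have hxH : x ∈ H := hTH i hx
    exact (H.mul_mem_cancel_right hxH).mp
      (hTH j (hmaps j x hxH (Set.disjoint_left.mp (hT hij) hx)))
  let e : Bool × Bool ≃ Fin 4 := Fintype.equivFinOfCardEq (by simp)
  refine ⟨H.subtype.comp (FreeGroup.lift _), H.subtype_injective.comp
    (FreeGroup.injective_lift_mul_of_ping_pong
      (fun p => (⟨_, hmem (e p)⟩ : H)) (fun p => ((↑) : H → Γ) ⁻¹' T (e p)) ?_ ?_ ?_)⟩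
  · intro p
    obtain ⟨x, hx⟩ := hne (e p)
    exact ⟨⟨x, hTH _ hx⟩, hx⟩
  · exact fun p q hpq => (hT (e.injective.ne hpq)).preimage _
  · exact fun p x hx => hmaps (e p) x x.2 hx
end

section
/- Let N be a normal subgroup of a group Γ. If the group N has property (BP) and the quotient group Γ/N has property (BP), then Γ has property (BP). -/
/-- Proposition 5.8: property (BP) is preserved by extensions: if a normal subgroup `N`
of `Γ` and the quotient `Γ/N` both have property (BP), then so does `Γ`. -/
theorem hasBP_of_extension {Γ : Type*} [Group Γ] (N : Subgroup Γ) [N.Normal]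
    (h1 : HasBP ↥N) (h2 : HasBP (Γ ⧸ N)) : HasBP Γ := by
  intro γ hγ n hn
  by_cases hN : γ ∈ N
  · obtain ⟨α, H, T, hTH, hdisj, hT⟩ := h1 ⟨γ, hN⟩ (by simpa [Subtype.ext_iff] using hγ) n hn
    refine ⟨fun j => α j, H.map N.subtype, fun j => Subtype.val '' T j, fun j => ?_,
      fun i j hij => ?_, fun j h hh hhT => ?_⟩
    · exact Set.image_mono (hTH j)
    · exact (Set.disjoint_image_iff Subtype.val_injective).2 (hdisj hij)
    · obtain ⟨x, hx, rfl⟩ := hh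
      exact ⟨_, hT j x hx fun hxT => hhT ⟨x, hxT, rfl⟩, rfl⟩
  · obtain ⟨α, H, T, hTH, hdisj, hT⟩ :=
      h2 (γ : Γ ⧸ N) (by rwa [Ne, QuotientGroup.eq_one_iff]) n hn
    choose β hβ using fun j => QuotientGroup.mk'_surjective N (α j)
    refine ⟨β, H.comap (QuotientGroup.mk' N), fun j => QuotientGroup.mk' N ⁻¹' T j,
      fun j => Set.preimage_mono (hTH j), fun i j hij => (hdisj hij).preimage _,
      fun j h hh hhT => ?_⟩
    have hmem := hT j (QuotientGroup.mk' N h) hh hhT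
    rw [← hβ j] at hmem
    exact hmem
end

section
/- Let Γ be a countable group with property (BP) and let α be an ergodic measure-preserving action of Γ on a standard probability space (Y, ν). Suppose α is not essentially free, i.e., ν(Fix(γ)) > 0 for some γ ∈ Γ ∖ {e}. Then for ν-almost every y ∈ Y the stabilizer Γ_y = {γ ∈ Γ : γ·y = y} contains a non-abelian free group: there exist u, v ∈ Γ_y such that the homomorphism from the free group on two generators to Γ sending the generators to u and v is injective. -/
open MeasureTheory

open scoped Pointwise ENNReal

/-- If `g j` maps the complement of `T j` into `T j` for four pairwise disjoint sets `T j`, then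
`g 0 * g 1` and `g 2 * g 3` freely generate a free group. -/
theorem FreeGroup.injective_lift_mul_of_mapsTo_compl {G : Type*} [Group G] {X : Type*}
    [MulAction G X] [Nonempty X] (g : Fin 4 → G) (T : Fin 4 → Set X)
    (hdisj : Pairwise fun i j => Disjoint (T i) (T j))
    (hT : ∀ j, ∀ x ∉ T j, g j • x ∈ T j) :
    Function.Injective
      (FreeGroup.lift fun b : Bool => if b then g 0 * g 1 else g 2 * g 3) := by
  have hne : ∀ j, (T j).Nonempty := fun j => by
    obtain ⟨x⟩ := ‹Nonempty X›
    by_cases hx : x ∈ T j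
    exacts [⟨x, hx⟩, ⟨_, hT j x hx⟩]
  have hTinv : ∀ j, ∀ x ∉ T j, (g j)⁻¹ • x ∈ T j := fun j x hx => by
    by_contra h
    exact hx (by simpa using hT j _ h)
  have hnot : ∀ {i j} (x), i ≠ j → x ∈ T i → x ∉ T j :=
    fun x hij hi => Set.disjoint_left.1 (hdisj hij) hi
  have hmul : ∀ {i j}, i ≠ j → (g i * g j) • (T j)ᶜ ⊆ T i := by
    rintro i j hij _ ⟨x, hx, rfl⟩
    simpa only [mul_smul] using hT i _ (hnot _ hij.symm (hT j x hx))
  have hmulinv : ∀ {i j}, i ≠ j → (g i * g j)⁻¹ • (T i)ᶜ ⊆ T j := by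
    rintro i j hij _ ⟨x, hx, rfl⟩
    simpa only [mul_inv_rev, mul_smul] using hTinv j _ (hnot _ hij (hTinv i x hx))
  -- The ping-pong lemma requires the generators to live in the universe of `G`.
  have key : Function.Injective (FreeGroup.lift fun b : ULift Bool =>
      if b.down then g 0 * g 1 else g 2 * g 3) := by
    refine FreeGroup.injective_lift_of_ping_pong _
      (fun b => if b.down then T 0 else T 2) (fun b => if b.down then T 1 else T 3)
      ?_ ?_ ?_ ?_ ?_ ?_
    · rintro ⟨_ | _⟩ <;> exact hne _
    · rintro ⟨_ | _⟩ ⟨_ | _⟩ h <;> first | exact absurd rfl h | exact hdisj (by decide)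
    · rintro ⟨_ | _⟩ ⟨_ | _⟩ h <;> first | exact absurd rfl h | exact hdisj (by decide)
    · rintro ⟨_ | _⟩ ⟨_ | _⟩ <;> exact hdisj (by decide)
    · rintro ⟨_ | _⟩ <;> exact hmul (by decide)
    · rintro ⟨_ | _⟩ <;> exact hmulinv (by decide)
  have hcomp : (FreeGroup.lift fun b : Bool => if b then g 0 * g 1 else g 2 * g 3) =
      (FreeGroup.lift fun b : ULift Bool => if b.down then g 0 * g 1 else g 2 * g 3).comp
        (FreeGroup.freeGroupCongr Equiv.ulift.symm).toMonoidHom := by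
    ext b
    simp
  rw [hcomp, MonoidHom.coe_comp]
  exact key.comp (MulEquiv.injective _)

/-- If pairwise disjoint subsets `T j` of a subgroup `H` satisfy `g j * h ∈ T j` for every
`h ∈ H` outside `T j`, then every `g j` lies in `H`. -/
theorem Subgroup.mem_of_forall_mul_mem {G ι : Type*} [Group G] [Nontrivial ι] {H : Subgroup G}
    {g : ι → G} {T : ι → Set G} (hTH : ∀ j, T j ⊆ H)
    (hdisj : Pairwise fun i j => Disjoint (T i) (T j))
    (hT : ∀ j, ∀ h ∈ H, h ∉ T j → g j * h ∈ T j) (j : ι) : g j ∈ H := by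
  obtain ⟨i, hij⟩ := exists_ne j
  obtain ⟨h, hH, hh⟩ : ∃ h ∈ H, h ∉ T j := by
    by_cases h1 : (1 : G) ∈ T i
    · exact ⟨1, H.one_mem, Set.disjoint_left.1 (hdisj hij) h1⟩
    · have h2 := hT i 1 H.one_mem h1
      exact ⟨_, hTH i h2, Set.disjoint_left.1 (hdisj hij) h2⟩
  exact (H.mul_mem_cancel_right hH).1 (hTH j (hT j h hH hh))

/-- Ping-pong for four group elements and four pairwise disjoint subsets of a subgroup. -/
theorem FreeGroup.injective_lift_mul_of_subgroup {G : Type*} [Group G] {H : Subgroup G}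
    (g : Fin 4 → G) (T : Fin 4 → Set G) (hTH : ∀ j, T j ⊆ H)
    (hdisj : Pairwise fun i j => Disjoint (T i) (T j))
    (hT : ∀ j, ∀ h ∈ H, h ∉ T j → g j * h ∈ T j) :
    Function.Injective
      (FreeGroup.lift fun b : Bool => if b then g 0 * g 1 else g 2 * g 3) := by
  have hg := Subgroup.mem_of_forall_mul_mem hTH hdisj hT
  have key := FreeGroup.injective_lift_mul_of_mapsTo_compl (fun j => (⟨g j, hg j⟩ : H))
    (fun j => ((↑) : H → G) ⁻¹' T j) (fun i j hij => (hdisj hij).preimage _)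
    (fun j x hx => hT j x x.2 hx)
  have hcomp : (FreeGroup.lift fun b : Bool => if b then g 0 * g 1 else g 2 * g 3) =
      H.subtype.comp (FreeGroup.lift fun b : Bool =>
        if b then (⟨g 0, hg 0⟩ : H) * ⟨g 1, hg 1⟩ else ⟨g 2, hg 2⟩ * ⟨g 3, hg 3⟩) := by
    ext b
    cases b <;> simp
  rw [hcomp, MonoidHom.coe_comp]
  exact H.subtype_injective.comp key

/-- If finitely many measurable subsets of a probability space have measures summing to more than
`k`, then with positive probability a point lies in more than `k` of them. -/
theorem MeasureTheory.exists_lt_card_of_lt_sum_measure {Ω ι : Type*} [MeasurableSpace Ω]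
    [Fintype ι] (μ : Measure Ω) [IsProbabilityMeasure μ] {A : ι → Set Ω}
    (hA : ∀ i, MeasurableSet (A i)) {k : ℕ} (hk : (k : ℝ≥0∞) < ∑ i, μ (A i)) :
    ∃ᵐ x ∂μ, ∃ s : Finset ι, k < s.card ∧ ∀ i ∈ s, x ∈ A i := by
  classical
  intro h
  refine hk.not_ge ?_
  calc ∑ i, μ (A i) = ∫⁻ x, ∑ i, (A i).indicator 1 x ∂μ := by
        rw [lintegral_finsetSum _ fun i _ => measurable_one.indicator (hA i)]
        simp [hA]
    _ ≤ ∫⁻ _, k ∂μ := by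
        refine lintegral_mono_ae (h.mono fun x hx => ?_)
        have hcard : (Finset.univ.filter fun i => x ∈ A i).card ≤ k := by
          by_contra! hlt
          exact hx ⟨_, hlt, fun i hi => (Finset.mem_filter.1 hi).2⟩
        simpa [Set.indicator_apply, Finset.sum_boole] using hcard
    _ = k := by simp

/-- The set of points whose stabilizer contains a free group on two generators is invariant. -/
theorem MulAction.exists_injective_lift_smul_iff {G Y : Type*} [Group G] [MulAction G Y]
    (γ : G) (y : Y) :
    (∃ u v : G, u • γ • y = γ • y ∧ v • γ • y = γ • y ∧
      Function.Injective (FreeGroup.lift fun b : Bool => if b then u else v)) ↔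
    ∃ u v : G, u • y = y ∧ v • y = y ∧
      Function.Injective (FreeGroup.lift fun b : Bool => if b then u else v) := by
  have key : ∀ (γ : G) (y : Y), (∃ u v : G, u • y = y ∧ v • y = y ∧
      Function.Injective (FreeGroup.lift fun b : Bool => if b then u else v)) →
      ∃ u v : G, u • γ • y = γ • y ∧ v • γ • y = γ • y ∧
        Function.Injective (FreeGroup.lift fun b : Bool => if b then u else v) := by
    rintro γ y ⟨u, v, hu, hv, hinj⟩
    refine ⟨γ * u * γ⁻¹, γ * v * γ⁻¹, by simp [mul_smul, hu], by simp [mul_smul, hv], ?_⟩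
    have hcomp : (FreeGroup.lift fun b : Bool => if b then γ * u * γ⁻¹ else γ * v * γ⁻¹) =
        (MulAut.conj γ).toMonoidHom.comp
          (FreeGroup.lift fun b : Bool => if b then u else v) := by
      ext b
      cases b <;> simp
    rw [hcomp, MonoidHom.coe_comp]
    exact (MulEquiv.injective _).comp hinj
  exact ⟨fun h => by simpa using key γ⁻¹ _ h, key γ y⟩

/-- Theorem 5.6: if a countable group `Γ` with property (BP) acts ergodically and
non-freely on a standard probability space, then almost every stabilizer contains
a non-abelian free group. -/
theorem stabilizer_contains_free_group_of_hasBP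
    {Γ : Type*} [Group Γ] [Countable Γ] (hBP : HasBP Γ)
    {Y : Type*} [MeasurableSpace Y] [StandardBorelSpace Y]
    (ν : Measure Y) [IsProbabilityMeasure ν] [MulAction Γ Y]
    (hpres : ∀ γ : Γ, MeasurePreserving (fun y : Y => γ • y) ν ν)
    (hFix : ∀ γ : Γ, MeasurableSet {y : Y | γ • y = y})
    (herg : ∀ A : Set Y, MeasurableSet A →
      (∀ γ : Γ, (fun y : Y => γ • y) ⁻¹' A = A) → ν A = 0 ∨ ν A = 1)
    (hnonfree : ∃ γ : Γ, γ ≠ 1 ∧ 0 < ν {y : Y | γ • y = y}) :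
    ∀ᵐ y ∂ν, ∃ u v : Γ, u • y = y ∧ v • y = y ∧
      Function.Injective ⇑(FreeGroup.lift fun b : Bool => if b then u else v) := by
  have hmeas : MeasurableSet {y : Y | ∃ u v : Γ, u • y = y ∧ v • y = y ∧
      Function.Injective ⇑(FreeGroup.lift fun b : Bool => if b then u else v)} := by
    simp only [Set.ofPred_exists]
    exact .iUnion fun u => .iUnion fun v => (hFix u).inter ((hFix v).inter (.const _))
  have hpos : ∃ᵐ y ∂ν, ∃ u v : Γ, u • y = y ∧ v • y = y ∧
      Function.Injective ⇑(FreeGroup.lift fun b : Bool => if b then u else v) := by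
    obtain ⟨γ, hγ, hγpos⟩ := hnonfree
    obtain ⟨n, hn⟩ := ENNReal.exists_nat_mul_gt hγpos.ne' (ENNReal.natCast_ne_top 3)
    have hn2 : 2 ≤ n := by
      by_contra! hlt
      have hle : (n : ℝ≥0∞) * ν {y : Y | γ • y = y} ≤ 3 * 1 :=
        mul_le_mul' (by exact_mod_cast (by omega : n ≤ 3)) prob_le_one
      exact hn.not_ge (by simpa using hle)
    obtain ⟨α, H, T, hTH, hdisj, hT⟩ := hBP γ hγ n hn2
    have hν : ∀ j, ν {y : Y | (α j * γ * (α j)⁻¹) • y = y} = ν {y : Y | γ • y = y} := by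
      intro j
      rw [← (hpres (α j)⁻¹).measure_preimage (hFix γ).nullMeasurableSet]
      congr 1
      ext y
      simp [mul_smul, eq_inv_smul_iff]
    refine (exists_lt_card_of_lt_sum_measure ν
      (A := fun j => {y : Y | (α j * γ * (α j)⁻¹) • y = y}) (fun j => hFix _) (k := 3)
      (by simpa [hν] using hn)).mono ?_
    rintro y ⟨s, hs, hy⟩
    obtain ⟨t, hts, ht⟩ := Finset.exists_subset_card_eq (show 4 ≤ s.card from hs)
    let e := t.orderEmbOfFin ht
    have hfix : ∀ i, (α (e i) * γ * (α (e i))⁻¹) • y = y :=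
      fun i => hy _ (hts (t.orderEmbOfFin_mem ht i))
    refine ⟨_, _, ?_, ?_, FreeGroup.injective_lift_mul_of_subgroup
      (fun i => α (e i) * γ * (α (e i))⁻¹) (fun i => T (e i)) (fun i => hTH _)
      (fun i j hij => hdisj (e.injective.ne hij)) (fun i => hT _)⟩
    · rw [mul_smul, hfix, hfix]
    · rw [mul_smul, hfix, hfix]
  rcases herg _ hmeas fun γ => Set.ext fun y => MulAction.exists_injective_lift_smul_iff γ y
    with h | h
  · exact absurd (measure_eq_zero_iff_ae_notMem.1 h) hpos
  · exact (prob_compl_eq_zero_iff hmeas).2 h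
end

section
/- (Takahasi) Let F be a free group and let r be a natural number. Suppose H₀ ≤ H₁ ≤ H₂ ≤ ⋯ is an ascending chain of subgroups of F such that each Hₙ is generated by at most r elements (equivalently, each Hₙ, which is a free group by the Nielsen–Schreier theorem, has rank at most r). Then all Hₙ coincide for n sufficiently large: there exists N such that Hₙ = H_N for all n ≥ N. -/
/-- A basis of a free group generates it. -/
theorem FreeGroupBasis.closure_range {ι G : Type*} [Group G] (b : FreeGroupBasis ι G) :
    Subgroup.closure (Set.range b) = ⊤ := by
  have hb : (b : ι → G) = b.repr.symm.toMonoidHom ∘ FreeGroup.of := rfl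
  rw [hb, Set.range_comp, ← MonoidHom.map_closure, FreeGroup.closure_range_of]
  exact Subgroup.map_top_of_surjective _ b.repr.symm.surjective

/-- In a free group, a subgroup generated by a finite set `S` contains at most `S.card` elements
of any given basis. -/
theorem FreeGroupBasis.card_le_card_of_mem_closure {ι G : Type*} [Group G]
    (b : FreeGroupBasis ι G) (S : Finset G) (T : Finset ι)
    (hT : ∀ i ∈ T, b i ∈ Subgroup.closure (S : Set G)) : T.card ≤ S.card := by
  classical
  let φ : G →* Multiplicative (ι →₀ ℚ) :=
    b.lift fun i => Multiplicative.ofAdd (Finsupp.single i 1)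
  have hφ : ∀ i, (φ (b i)).toAdd = Finsupp.single i (1 : ℚ) := fun i => by simp [φ]
  let w : Finset (ι →₀ ℚ) := S.image fun g => (φ g).toAdd
  have hspan : ∀ g ∈ Subgroup.closure (S : Set G),
      (φ g).toAdd ∈ Submodule.span ℚ (w : Set (ι →₀ ℚ)) := by
    intro g hg
    induction hg using Subgroup.closure_induction with
    | mem x hx => exact Submodule.subset_span (Finset.mem_coe.2 (Finset.mem_image_of_mem _ hx))
    | one => simp
    | mul x y _ _ hx hy => simpa using add_mem hx hy
    | inv x _ hx => simpa using hx
  have hli : LinearIndependent ℚ fun i : T => Finsupp.single (i : ι) (1 : ℚ) :=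
    (Finsupp.linearIndependent_single_one ℚ ι).comp _ Subtype.val_injective
  have hcard := linearIndependent_le_span_aux' _ hli (w : Set (ι →₀ ℚ)) <| by
    rintro _ ⟨i, rfl⟩
    simpa only [hφ, SetLike.mem_coe] using hspan _ (hT i i.2)
  calc T.card ≤ w.card := by simpa using hcard
    _ ≤ S.card := Finset.card_image_le

/-- Corollary 6.13 (Takahasi): an ascending chain of subgroups of a free group, each
generated by at most `r` elements, is eventually constant. -/
theorem takahasi_ascending_chain {α : Type*} (r : ℕ)
    (H : ℕ → Subgroup (FreeGroup α)) (hmono : Monotone H)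
    (hrank : ∀ n : ℕ, ∃ S : Finset (FreeGroup α), S.card ≤ r ∧
      Subgroup.closure (S : Set (FreeGroup α)) = H n) :
    ∃ N : ℕ, ∀ n : ℕ, N ≤ n → H n = H N := by
  classical
  let U : Subgroup (FreeGroup α) := ⨆ n, H n
  have hU : ∀ n, H n ≤ U := le_iSup H
  let b := IsFreeGroup.basis U
  have hmem : ∀ T : Finset (IsFreeGroup.Generators U),
      ∃ n, ∀ i ∈ T, (b i : FreeGroup α) ∈ H n := by
    have hex : ∀ i, ∃ n, (b i : FreeGroup α) ∈ H n := fun i =>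
      (Subgroup.mem_iSup_of_directed hmono.directed_le).1 (b i).2
    choose f hf using hex
    exact fun T => ⟨T.sup f, fun i hi => hmono (Finset.le_sup hi) (hf i)⟩
  rcases finite_or_infinite (IsFreeGroup.Generators U) with hfin | hinf
  · have := Fintype.ofFinite (IsFreeGroup.Generators U)
    obtain ⟨N, hN⟩ := hmem Finset.univ
    have hUN : U ≤ H N := by
      rw [← Subgroup.subgroupOf_eq_top, ← top_le_iff, ← b.closure_range, Subgroup.closure_le]
      rintro _ ⟨i, rfl⟩
      exact hN i (Finset.mem_univ i)
    exact ⟨N, fun n hn => le_antisymm ((hU n).trans hUN) (hmono hn)⟩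
  · obtain ⟨T, hT⟩ := Infinite.exists_subset_card_eq (IsFreeGroup.Generators U) (r + 1)
    obtain ⟨n, hn⟩ := hmem T
    obtain ⟨S, hSr, hS⟩ := hrank n
    have hSU : ∀ x ∈ S, x ∈ U := fun x hx => hU n (hS ▸ Subgroup.subset_closure hx)
    have hmap : (Subgroup.closure (S.subtype (· ∈ U) : Set U)).map U.subtype = H n := by
      rw [MonoidHom.map_closure, ← hS]
      congr 1
      ext x
      simpa using hSU x
    have hle := b.card_le_card_of_mem_closure (S.subtype (· ∈ U)) T fun i hi => by
      rw [← Subgroup.mem_map_iff_mem U.subtype_injective, hmap]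
      exact hn i hi
    have hSle : (S.subtype (· ∈ U)).card ≤ S.card := by
      rw [Finset.card_subtype]
      exact Finset.card_filter_le _ _
    omega
end

section
/- Let Γ be a group and let 𝒫_Γ denote the set of all equivalence relations on Γ, equipped with the left-translation action of Γ defined by: (γ·P) relates (α, β) if and only if P relates (γ⁻¹α, γ⁻¹β). Let Γ also act on a set Z, and consider the diagonal action of Γ on 𝒫_Γ × Z. Define a relation F on 𝒫_Γ × Z by: (P, x) F (Q, y) if and only if there exists γ ∈ Γ such that P relates γ⁻¹ and e, γ·P = Q, and γ·x = y. Then F is an equivalence relation on 𝒫_Γ × Z. Moreover, if the action of Γ on Z is free (γ·z = z implies γ = e), then for every (P, x) ∈ 𝒫_Γ × Z and all α, β ∈ Γ: (α⁻¹·(P, x)) F (β⁻¹·(P, x)) holds if and only if P relates α and β. -/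
/-- The left-translation action of `Γ` on the space of equivalence relations
(setoids) on `Γ`: `(γ·P)` relates `(α, β)` iff `P` relates `(γ⁻¹α, γ⁻¹β)`. -/
def translateSetoid {Γ : Type*} [Group Γ] (γ : Γ) (P : Setoid Γ) : Setoid Γ where
  r a b := P.r (γ⁻¹ * a) (γ⁻¹ * b)
  iseqv :=
    { refl := fun a => P.iseqv.refl _
      symm := fun h => P.iseqv.symm h
      trans := fun h1 h2 => P.iseqv.trans h1 h2 }

theorem translateSetoid_one {Γ : Type*} [Group Γ] (P : Setoid Γ) :
    translateSetoid 1 P = P := by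
  refine Setoid.ext fun a b => ?_
  change P.r (1⁻¹ * a) (1⁻¹ * b) ↔ P.r a b
  simp only [inv_one, one_mul]

theorem translateSetoid_mul {Γ : Type*} [Group Γ] (γ δ : Γ) (P : Setoid Γ) :
    translateSetoid (γ * δ) P = translateSetoid γ (translateSetoid δ P) := by
  refine Setoid.ext fun a b => ?_
  change P.r ((γ * δ)⁻¹ * a) ((γ * δ)⁻¹ * b) ↔ P.r (δ⁻¹ * (γ⁻¹ * a)) (δ⁻¹ * (γ⁻¹ * b))
  simp only [mul_inv_rev, mul_assoc]

/-- Theorem A.4: the relation `F` on `𝒫_Γ × Z` given by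
`(P, x) F (Q, y) ↔ ∃ γ, P(γ⁻¹, e) ∧ γ·P = Q ∧ γ·x = y` is an equivalence relation,
and if `Γ` acts freely on `Z` then `α⁻¹·(P,x) F β⁻¹·(P,x)` iff `P` relates `(α, β)`. -/
theorem partition_equivalence_relation
    {Γ : Type*} [Group Γ] {Z : Type*} [MulAction Γ Z] :
    let F : Setoid Γ × Z → Setoid Γ × Z → Prop := fun p q =>
      ∃ γ : Γ, p.1.r γ⁻¹ 1 ∧ translateSetoid γ p.1 = q.1 ∧ γ • p.2 = q.2
    Equivalence F ∧
    ((∀ (γ : Γ) (z : Z), γ • z = z → γ = 1) →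
      ∀ (P : Setoid Γ) (x : Z) (α β : Γ),
        F (translateSetoid α⁻¹ P, α⁻¹ • x) (translateSetoid β⁻¹ P, β⁻¹ • x) ↔ P.r α β) := by
  intro F
  refine ⟨⟨?_, ?_, ?_⟩, ?_⟩
  · rintro ⟨P, x⟩
    refine ⟨1, ?_, translateSetoid_one P, one_smul Γ x⟩
    rw [inv_one]
  · rintro ⟨P, x⟩ ⟨_, _⟩ ⟨γ, h, rfl, rfl⟩
    refine ⟨γ⁻¹, ?_, ?_, inv_smul_smul γ x⟩
    · change P.r (γ⁻¹ * γ⁻¹⁻¹) (γ⁻¹ * 1)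
      rw [mul_inv_cancel, mul_one]
      exact P.iseqv.symm h
    · rw [← translateSetoid_mul, inv_mul_cancel, translateSetoid_one]
  · rintro ⟨P, x⟩ ⟨_, _⟩ ⟨_, _⟩ ⟨γ, hγ, rfl, rfl⟩ ⟨δ, hδ, rfl, rfl⟩
    refine ⟨δ * γ, ?_, translateSetoid_mul δ γ P, mul_smul δ γ x⟩
    change P.r (γ⁻¹ * δ⁻¹) (γ⁻¹ * 1) at hδ
    rw [mul_one] at hδ
    rw [mul_inv_rev]
    exact P.iseqv.trans hδ hγ
  · intro hfree P x α β
    constructor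
    · rintro ⟨γ, h, -, hx⟩
      have hγ : β * γ * α⁻¹ = 1 := hfree _ x (by
        rw [mul_assoc, mul_smul, mul_smul]
        exact (congrArg (β • ·) hx).trans (smul_inv_smul β x))
      change P.r (α⁻¹⁻¹ * γ⁻¹) (α⁻¹⁻¹ * 1) at h
      have hβ : α * γ⁻¹ = β := by
        rw [← mul_inv_eq_one.mp hγ, mul_inv_cancel_right]
      rw [inv_inv, mul_one, hβ] at h
      exact P.iseqv.symm h
    · intro h
      refine ⟨β⁻¹ * α, ?_, ?_, ?_⟩
      · change P.r (α⁻¹⁻¹ * (β⁻¹ * α)⁻¹) (α⁻¹⁻¹ * 1)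
        rw [inv_inv, mul_inv_rev, inv_inv, mul_inv_cancel_left, mul_one]
        exact P.iseqv.symm h
      · rw [← translateSetoid_mul, mul_inv_cancel_right]
      · rw [smul_smul, mul_inv_cancel_right]
end

section
/- Let Γ be a group acting freely on a set Z (γ·z = z implies γ = e). Let Γ act diagonally on Sub_Γ × Z, where Sub_Γ is the set of subgroups of Γ with the conjugation action, via γ·(H, x) = (γHγ⁻¹, γ·x). Define the relation F₀ on Sub_Γ × Z by: (H, x) F₀ (L, y) if and only if H = L and h·x = y for some h ∈ H. Then: (i) F₀ is an equivalence relation; (ii) F₀ is normalized by the action, i.e., (H, x) F₀ (L, y) implies (γ·(H, x)) F₀ (γ·(L, y)) for every γ ∈ Γ; and (iii) for every (H, x) ∈ Sub_Γ × Z, the set {γ ∈ Γ : (γ⁻¹·(H, x)) F₀ (H, x)} equals H. -/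
/-- A subgroup is invariant under conjugation by its own elements. -/
theorem map_conj_eq_self_of_mem {G : Type*} [Group G] {H : Subgroup G} {g : G} (hg : g ∈ H) :
    H.map (MulAut.conj g).toMonoidHom = H := by
  ext k
  constructor
  · rintro ⟨h, hh, rfl⟩
    exact H.mul_mem (H.mul_mem hg hh) (H.inv_mem hg)
  · intro hk
    exact ⟨g⁻¹ * k * g, H.mul_mem (H.mul_mem (H.inv_mem hg) hk) hg, by simp [mul_assoc]⟩

/-- Corollary A.12 (algebraic content): for a free action of `Γ` on `Z`, the relation
`F₀` on `Sub_Γ × Z` given by `(H, x) F₀ (L, y) ↔ H = L ∧ ∃ h ∈ H, h • x = y` is an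
equivalence relation, is normalized by the diagonal action
`γ·(H, x) = (γHγ⁻¹, γ • x)`, and satisfies `{γ : γ⁻¹·(H,x) F₀ (H,x)} = H`. -/
theorem subgroup_equivalence_relation_normalized
    {Γ : Type*} [Group Γ] {Z : Type*} [MulAction Γ Z]
    (hfree : ∀ (γ : Γ) (z : Z), γ • z = z → γ = 1) :
    let conj : Γ → Subgroup Γ → Subgroup Γ :=
      fun γ H => Subgroup.map (MulAut.conj γ).toMonoidHom H
    let F₀ : Subgroup Γ × Z → Subgroup Γ × Z → Prop := fun p q =>
      p.1 = q.1 ∧ ∃ h ∈ p.1, h • p.2 = q.2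
    Equivalence F₀ ∧
    (∀ (γ : Γ) (p q : Subgroup Γ × Z), F₀ p q →
      F₀ (conj γ p.1, γ • p.2) (conj γ q.1, γ • q.2)) ∧
    (∀ (H : Subgroup Γ) (x : Z),
      {γ : Γ | F₀ (conj γ⁻¹ H, γ⁻¹ • x) (H, x)} = (H : Set Γ)) := by
  intro conj F₀
  refine ⟨⟨fun p => ⟨rfl, 1, p.1.one_mem, one_smul _ _⟩, ?_, ?_⟩, ?_, ?_⟩
  · rintro ⟨H, x⟩ ⟨L, y⟩ ⟨rfl : H = L, h, hh, rfl : h • x = y⟩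
    exact ⟨rfl, h⁻¹, H.inv_mem hh, inv_smul_smul h x⟩
  · rintro ⟨H, x⟩ ⟨L, y⟩ ⟨K, z⟩ ⟨rfl : H = L, h, hh, rfl : h • x = y⟩
      ⟨rfl : H = K, k, hk, rfl : k • h • x = z⟩
    exact ⟨rfl, k * h, H.mul_mem hk hh, mul_smul k h x⟩
  · rintro γ ⟨H, x⟩ ⟨L, y⟩ ⟨rfl : H = L, h, hh, rfl : h • x = y⟩
    refine ⟨rfl, γ * h * γ⁻¹, ⟨h, hh, rfl⟩, ?_⟩
    simp [mul_smul]
  · intro H x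
    ext γ
    constructor
    · rintro ⟨hH : conj γ⁻¹ H = H, h, hh : h ∈ conj γ⁻¹ H, hx : h • γ⁻¹ • x = x⟩
      rw [hH] at hh
      have hγ : h = γ := mul_inv_eq_one.mp (hfree (h * γ⁻¹) x (by rwa [mul_smul]))
      exact hγ ▸ hh
    · intro hγ
      have hH : conj γ⁻¹ H = H := map_conj_eq_self_of_mem (H.inv_mem hγ)
      refine ⟨hH, γ, ?_, smul_inv_smul γ x⟩
      change γ ∈ conj γ⁻¹ H
      rwa [hH]
end

section
/- Let H be a countable group, let x ∈ H, and let T ⊆ H be a subset such that xh ∈ T for every h ∈ H ∖ T. Then for all square-summable functions f, g : H → ℂ (i.e., f, g ∈ ℓ²(H)), |∑_{h ∈ H} f(x⁻¹h)·conj(g(h))| ≤ ‖1_T·f‖₂·‖g‖₂ + ‖f‖₂·‖1_T·g‖₂; in other words, the matrix coefficient ⟨λ_H(x)f, g⟩ of the left regular representation satisfies |⟨λ_H(x)f, g⟩| ≤ ‖1_T f‖‖g‖ + ‖f‖‖1_T g‖. -/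
open scoped ComplexConjugate

/-- **Cauchy–Schwarz** for nonnegative square-summable families, the first one reindexed by a
permutation of the index set. -/
theorem summable_and_tsum_comp_mul_le_sqrt_mul_sqrt {ι : Type*} (e : ι ≃ ι) {u v : ι → ℝ}
    (hu : ∀ i, 0 ≤ u i) (hv : ∀ i, 0 ≤ v i)
    (hu_sum : Summable fun i => u i ^ 2) (hv_sum : Summable fun i => v i ^ 2) :
    (Summable fun i => u (e i) * v i) ∧
      ∑' i, u (e i) * v i ≤ √(∑' i, u i ^ 2) * √(∑' i, v i ^ 2) := by
  have he := e.summable_iff.2 hu_sum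
  have holder := Real.summable_and_inner_le_Lp_mul_Lq_tsum_of_nonneg
    Real.HolderConjugate.two_two (fun i => hu (e i)) hv
    (by simpa [Function.comp_def] using he) (by simpa using hv_sum)
  refine ⟨holder.1, holder.2.trans_eq ?_⟩
  rw [Real.sqrt_eq_rpow, Real.sqrt_eq_rpow, ← e.tsum_eq (fun i => u i ^ 2)]
  simp

/-- Square-summability is preserved by multiplication with an indicator function. -/
theorem summable_sq_norm_indicator {ι E : Type*} [SeminormedAddCommGroup E] (T : Set ι)
    {f : ι → E} (hf : Summable fun i => ‖f i‖ ^ 2) :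
    Summable fun i => ‖T.indicator f i‖ ^ 2 :=
  hf.of_nonneg_of_le (fun _ => by positivity) fun i => by
    gcongr
    exact norm_indicator_le_norm_self f i

/-- The key estimate in Remark 5.9 (following [BCH94, Lemma 2.2]): if `x ∈ H` and
`T ⊆ H` satisfy `x·(H ∖ T) ⊆ T`, then for all `f, g ∈ ℓ²(H)`,
`|⟨λ_H(x)f, g⟩| ≤ ‖1_T f‖‖g‖ + ‖f‖‖1_T g‖`. -/
theorem matrix_coefficient_estimate {H : Type*} [Group H] [Countable H]
    (x : H) (T : Set H) (hT : ∀ h : H, h ∉ T → x * h ∈ T)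
    (f g : H → ℂ) (hf : Memℓp f 2) (hg : Memℓp g 2) :
    ‖∑' h : H, f (x⁻¹ * h) * conj (g h)‖ ≤
      Real.sqrt (∑' h : H, ‖T.indicator f h‖ ^ 2) * Real.sqrt (∑' h : H, ‖g h‖ ^ 2) +
      Real.sqrt (∑' h : H, ‖f h‖ ^ 2) * Real.sqrt (∑' h : H, ‖T.indicator g h‖ ^ 2) := by
  have hf_sum : Summable fun h => ‖f h‖ ^ 2 := by
    simpa using hf.summable (by norm_num)
  have hg_sum : Summable fun h => ‖g h‖ ^ 2 := by
    simpa using hg.summable (by norm_num)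
  obtain ⟨hTf_summable, hTf_le⟩ := summable_and_tsum_comp_mul_le_sqrt_mul_sqrt
    (Equiv.mulLeft x⁻¹) (fun h => norm_nonneg (T.indicator f h)) (fun h => norm_nonneg (g h))
    (summable_sq_norm_indicator T hf_sum) hg_sum
  obtain ⟨hTg_summable, hTg_le⟩ := summable_and_tsum_comp_mul_le_sqrt_mul_sqrt
    (Equiv.mulLeft x⁻¹) (fun h => norm_nonneg (f h)) (fun h => norm_nonneg (T.indicator g h))
    hf_sum (summable_sq_norm_indicator T hg_sum)
  refine (tsum_of_norm_bounded (hTf_summable.add hTg_summable).hasSum fun h => ?_).trans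
    ((hTf_summable.tsum_add hTg_summable).trans_le (add_le_add hTf_le hTg_le))
  simp only [norm_mul, RCLike.norm_conj, Equiv.coe_mulLeft]
  by_cases hh : x⁻¹ * h ∈ T
  · rw [Set.indicator_of_mem hh]
    exact le_add_of_nonneg_right (by positivity)
  · have hmem : h ∈ T := by simpa using hT _ hh
    rw [Set.indicator_of_mem hmem]
    exact le_add_of_nonneg_left (by positivity)
end
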